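/- Let L be a c-utility act set on K, let â ∈ ℝ^K, and suppose there exists l ∈ L such that {p ∈ Δ(K) : ⟨p, l⟩ ≤ ⟨p, â⟩} ⊆ {p ∈ Δ(K) : h_L(p) ≤ ⟨p, â⟩} ⊆ {p ∈ Δ(K) : h_L(p) = ⟨p, l⟩}. Then: (a) for every p ∈ Δ(K), max(0, ⟨p, â⟩ − h_L(p)) = max(0, ⟨p, â − l⟩), and this function of p is convex on Δ(K); (b) closure(convexHull ℝ (L ∪ ({â} + ℝ₋^K))) = L + segment ℝ 0 (â − l) (Minkowski sum of L with the segment joining 0 to â − l). -/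

import Mathlib

open MeasureTheory Pointwise

/-- The pairing `⟨p, x⟩ = ∑ k, p k * x k`. -/
def pairing {K : Type} [Fintype K] (p x : K → ℝ) : ℝ := ∑ k, p k * x k

/-- The simplex of beliefs `Δ(K)`. -/
def simplexSet (K : Type) [Fintype K] : Set (K → ℝ) :=
  {p | (∀ k, 0 ≤ p k) ∧ ∑ k, p k = 1}

/-- The negative orthant `ℝ₋^K`. -/
def negOrthant (K : Type) [Fintype K] : Set (K → ℝ) := {v | ∀ k, v k ≤ 0}

/-- The restricted support function `h_G`. -/
noncomputable def suppFn {K : Type} [Fintype K] (G : Set (K → ℝ)) (p : K → ℝ) : ℝ :=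
  sSup ((fun g => pairing p g) '' G)

/-- A c-utility act set: nonempty, closed, convex, comprehensive, with
`{⟨p, g⟩ : g ∈ G}` bounded above for each belief `p`, and `h_G` continuous on the simplex. -/
def IsCUAS {K : Type} [Fintype K] (G : Set (K → ℝ)) : Prop :=
  G.Nonempty ∧ IsClosed G ∧ Convex ℝ G ∧
  (∀ g ∈ G, ∀ v ∈ negOrthant K, g + v ∈ G) ∧
  (∀ p ∈ simplexSet K, BddAbove ((fun g => pairing p g) '' G)) ∧
  ContinuousOn (suppFn G) (simplexSet K)

/-- The value of information of information structure `q` for decision maker `G`. -/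
noncomputable def VoI {K : Type} [Fintype K] (G : Set (K → ℝ)) {Ω : Type}
    [MeasurableSpace Ω] (ℙ : Measure Ω) (q : Ω → K → ℝ) : ℝ :=
  (∫ ω, suppFn G (q ω) ∂ℙ) - suppFn G (∫ ω, q ω ∂ℙ)

theorem pairing_add {K : Type} [Fintype K] (p x y : K → ℝ) :
    pairing p (x + y) = pairing p x + pairing p y :=
  dotProduct_add p x y

theorem pairing_sub {K : Type} [Fintype K] (p x y : K → ℝ) :
    pairing p (x - y) = pairing p x - pairing p y :=
  dotProduct_sub p x y

theorem pairing_smul {K : Type} [Fintype K] (p : K → ℝ) (t : ℝ) (x : K → ℝ) :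
    pairing p (t • x) = t * pairing p x :=
  dotProduct_smul t p x

theorem pairing_add_left {K : Type} [Fintype K] (p q x : K → ℝ) :
    pairing (p + q) x = pairing p x + pairing q x :=
  add_dotProduct p q x

theorem pairing_smul_left {K : Type} [Fintype K] (t : ℝ) (p x : K → ℝ) :
    pairing (t • p) x = t * pairing p x :=
  smul_dotProduct t p x

theorem convex_simplexSet (K : Type) [Fintype K] : Convex ℝ (simplexSet K) :=
  convex_stdSimplex ℝ K

theorem IsCUAS.pairing_le_suppFn {K : Type} [Fintype K] {L : Set (K → ℝ)} (hL : IsCUAS L)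
    {p : K → ℝ} (hp : p ∈ simplexSet K) {x : K → ℝ} (hx : x ∈ L) :
    pairing p x ≤ suppFn L p :=
  le_csSup (hL.2.2.2.2.1 p hp) (Set.mem_image_of_mem _ hx)

theorem convexOn_max_zero_pairing {K : Type} [Fintype K] (x : K → ℝ) :
    ConvexOn ℝ (simplexSet K) (fun p => max 0 (pairing p x)) := by
  refine (convexOn_const 0 (convex_simplexSet K)).sup
    ⟨convex_simplexSet K, fun p _ q _ s t _ _ _ => le_of_eq ?_⟩
  simp only [pairing_add_left, pairing_smul_left, smul_eq_mul]

/-- A point outside a closed convex set containing a translate of the negative orthant is strictly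
separated from that set by a belief. -/
theorem exists_mem_simplexSet_separating {K : Type} [Fintype K] {C : Set (K → ℝ)}
    (hconv : Convex ℝ C) (hclosed : IsClosed C) {g : K → ℝ}
    (hg : ∀ v ∈ negOrthant K, g + v ∈ C) {y : K → ℝ} (hy : y ∉ C) :
    ∃ p ∈ simplexSet K, ∀ c ∈ C, pairing p c < pairing p y := by
  classical
  obtain ⟨f, u, hfC, hfy⟩ := geometric_hahn_banach_closed_point hconv hclosed hy
  set w : K → ℝ := fun k => f (Pi.single k 1) with hw
  have hf (x : K → ℝ) : f x = pairing w x := by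
    rw [← f.coe_coe, LinearMap.pi_apply_eq_sum_univ]
    refine Finset.sum_congr rfl fun k _ => ?_
    rw [smul_eq_mul, mul_comm, hw]
    refine congrArg (fun e => f e * x k) (funext fun j => ?_)
    simp [Pi.single_apply, eq_comm]
  have hw_nonneg (k : K) : 0 ≤ w k := by
    by_contra! hk
    have hgu : f g < u := hfC g (by simpa using hg 0 fun _ => le_rfl)
    have hmem : ((u - f g) / w k) • (Pi.single k (1 : ℝ) : K → ℝ) ∈ negOrthant K := fun j => by
      have hle : (u - f g) / w k ≤ 0 := div_nonpos_of_nonneg_of_nonpos (by linarith) hk.le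
      by_cases hj : j = k
      · subst hj; simpa using hle
      · simp [hj]
    have hlt := hfC _ (hg _ hmem)
    rw [map_add, map_smul, smul_eq_mul, div_mul_cancel₀ _ hk.ne] at hlt
    linarith
  have hlt (c : K → ℝ) (hc : c ∈ C) : pairing w c < pairing w y := by
    rw [← hf, ← hf]
    exact (hfC c hc).trans hfy
  have hsum : 0 < ∑ k, w k := by
    refine (Finset.sum_nonneg fun k _ => hw_nonneg k).lt_of_ne' fun h0 => ?_
    have hw0 := (Finset.sum_eq_zero_iff_of_nonneg fun k _ => hw_nonneg k).1 h0
    have hgy := hlt _ (hg 0 fun _ => le_rfl)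
    simp [pairing, fun k => hw0 k (Finset.mem_univ k)] at hgy
  refine ⟨(∑ k, w k)⁻¹ • w, ⟨fun k => mul_nonneg (inv_nonneg.2 hsum.le) (hw_nonneg k), ?_⟩,
    fun c hc => ?_⟩
  · simp only [Pi.smul_apply, smul_eq_mul, ← Finset.mul_sum]
    exact inv_mul_cancel₀ hsum.ne'
  · rw [pairing_smul_left, pairing_smul_left]
    exact mul_lt_mul_of_pos_left (hlt c hc) (inv_pos.2 hsum)

theorem little_flexibility_values_information_more_sufficient_condition
    {K : Type} [Fintype K] [Nonempty K] (L : Set (K → ℝ)) (hL : IsCUAS L)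
    (a : K → ℝ) (l : K → ℝ) (hl : l ∈ L)
    (h1 : {p ∈ simplexSet K | pairing p l ≤ pairing p a}
        ⊆ {p ∈ simplexSet K | suppFn L p ≤ pairing p a})
    (h2 : {p ∈ simplexSet K | suppFn L p ≤ pairing p a}
        ⊆ {p ∈ simplexSet K | suppFn L p = pairing p l}) :
    (∀ p ∈ simplexSet K,
      max 0 (pairing p a - suppFn L p) = max 0 (pairing p (a - l))) ∧
    ConvexOn ℝ (simplexSet K) (fun p => max 0 (pairing p a - suppFn L p)) ∧
    closure (convexHull ℝ (L ∪ (({a} : Set (K → ℝ)) + negOrthant K)))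
      = L + segment ℝ 0 (a - l) := by
  have hsupp {p : K → ℝ} (hp : p ∈ simplexSet K) (hle : pairing p l ≤ pairing p a) :
      suppFn L p = pairing p l := (h2 (h1 ⟨hp, hle⟩)).2
  have hmax : ∀ p ∈ simplexSet K,
      max 0 (pairing p a - suppFn L p) = max 0 (pairing p (a - l)) := fun p hp => by
    rw [pairing_sub]
    rcases le_or_gt (pairing p l) (pairing p a) with hle | hlt
    · rw [hsupp hp hle]
    · have hl_le := hL.pairing_le_suppFn hp hl
      rw [max_eq_left (by linarith), max_eq_left (by linarith)]
  refine ⟨hmax, (convexOn_max_zero_pairing (a - l)).congr fun p hp => (hmax p hp).symm, ?_⟩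
  obtain ⟨-, hclosed, hconv, hcomp, -⟩ := id hL
  apply Set.Subset.antisymm
  · refine closure_minimal (convexHull_min (Set.union_subset ?_ ?_)
      (hconv.add (convex_segment _ _))) (hclosed.add_right_of_isCompact ?_)
    · exact fun x hx => ⟨x, hx, 0, left_mem_segment ℝ _ _, add_zero x⟩
    · rintro _ ⟨b, hb, v, hv, rfl⟩
      obtain rfl : b = a := hb
      exact ⟨l + v, hcomp l hl v hv, b - l, right_mem_segment ℝ _ _, by dsimp only; abel⟩
    · rw [segment_eq_image_lineMap]
      exact isCompact_Icc.image (by fun_prop)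
  · rintro _ ⟨x, hx, z, hz, rfl⟩
    rw [segment_eq_image'] at hz
    obtain ⟨t, ⟨ht0, ht1⟩, rfl⟩ := hz
    by_contra hy
    have hsub : L ∪ (({a} : Set (K → ℝ)) + negOrthant K) ⊆
        closure (convexHull ℝ (L ∪ (({a} : Set (K → ℝ)) + negOrthant K))) :=
      (subset_convexHull ℝ _).trans subset_closure
    obtain ⟨p, hp, hlt⟩ := exists_mem_simplexSet_separating (convex_convexHull ℝ _).closure
      isClosed_closure (fun v hv => hsub (Or.inl (hcomp l hl v hv))) hy
    have hxlt := hlt x (hsub (Or.inl hx))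
    have halt := hlt a (hsub (Or.inr ⟨a, rfl, 0, fun _ => le_rfl, add_zero a⟩))
    simp only [zero_add, sub_zero, pairing_add, pairing_smul, pairing_sub] at hxlt halt
    rcases le_or_gt (pairing p l) (pairing p a) with hle | hgt
    · have hxl := hL.pairing_le_suppFn hp hx
      rw [hsupp hp hle] at hxl
      nlinarith
    · nlinarith
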